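/- Let q ≥ 2 be an integer and let θ_q^{−1} : [0,1) → [q+1,∞) denote the inverse of the bijection θ_q. For every integer m ≥ 2 and every t ∈ [cos(π/m), cos(π/(m+1))], one has f_{m−1}(t) ≠ 0 and θ_q^{−1}(t) = 1 + (q^{(m+1)/2} + q^{m/2}·u) / (1 + √q·u), where u := f_{m+1}(t)/f_{m−1}(t). -/

import Mathlib

open Real Set

/-- For an integer `m ≥ 2`, the function
`F_m(φ) = -cos((m+1)φ/2) / cos((m-1)φ/2)`. -/
noncomputable def Fm (m : ℕ) (φ : ℝ) : ℝ :=
  -Real.cos (((m : ℝ) + 1) * φ / 2) / Real.cos (((m : ℝ) - 1) * φ / 2)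

/-- The quantity `u(N) = ((q^{(m+1)/2} − q^{(m−1)/2})/(N − 1 − q^{(m−1)/2}) − 1)/√q`. -/
noncomputable def uN (q m : ℕ) (N : ℝ) : ℝ :=
  (((q : ℝ) ^ (((m : ℝ) + 1) / 2) - (q : ℝ) ^ (((m : ℝ) - 1) / 2)) /
      (N - 1 - (q : ℝ) ^ (((m : ℝ) - 1) / 2)) - 1) / Real.sqrt q

/-- `θ` is the function `θ_q`: for every real `N ≥ q+1`, whenever `m ≥ 2` is the integer
with `q^{m/2} ≤ N−1 < q^{(m+1)/2}` and `φ ∈ [π/(m+1), π/m]` satisfies `F_m(φ) = u(N)`,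
then `θ(N) = cos φ`. -/
def IsTheta (q : ℕ) (θ : ℝ → ℝ) : Prop :=
  ∀ N : ℝ, (q : ℝ) + 1 ≤ N → ∀ m : ℕ, 2 ≤ m →
    (q : ℝ) ^ ((m : ℝ) / 2) ≤ N - 1 → N - 1 < (q : ℝ) ^ (((m : ℝ) + 1) / 2) →
    ∀ φ ∈ Set.Icc (π / ((m : ℝ) + 1)) (π / (m : ℝ)),
      Fm m φ = uN q m N → θ N = Real.cos φ

/-- The polynomial `f_n(t) = Σ_{i=0}^{⌊n/2⌋} (n/(n−i))·C(n−i, i)·(−2t−2)^{⌊n/2⌋−i}`. -/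
noncomputable def fpoly (n : ℕ) (t : ℝ) : ℝ :=
  ∑ i ∈ Finset.range (n / 2 + 1),
    ((n : ℝ) / ((n : ℝ) - (i : ℝ))) * (Nat.choose (n - i) i : ℝ) *
      (-2 * t - 2) ^ (n / 2 - i)

/-- Pascal-type recurrence for the coefficients of the Dickson polynomials. -/
lemma dickson_coeff_succ_succ {n i : ℕ} (hi : i < n) :
    (((n + 2 : ℕ) : ℝ) / (((n + 2 : ℕ) : ℝ) - ((i + 1 : ℕ) : ℝ))) *
        (Nat.choose (n + 2 - (i + 1)) (i + 1) : ℝ) =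
      (((n + 1 : ℕ) : ℝ) / (((n + 1 : ℕ) : ℝ) - ((i + 1 : ℕ) : ℝ))) *
          (Nat.choose (n + 1 - (i + 1)) (i + 1) : ℝ) +
        ((n : ℝ) / ((n : ℝ) - (i : ℝ))) * (Nat.choose (n - i) i : ℝ) := by
  obtain ⟨p, rfl⟩ := Nat.exists_eq_add_of_lt hi
  have e1 : i + p + 1 + 2 - (i + 1) = p + 1 + 1 := by omega
  have e2 : i + p + 1 + 1 - (i + 1) = p + 1 := by omega
  have e3 : i + p + 1 - i = p + 1 := by omega
  have hA : (((p + 1).succ * (p + 1).choose i : ℕ) : ℝ) =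
      (((p + 1).succ.choose i.succ * i.succ : ℕ) : ℝ) :=
    congrArg _ (Nat.add_one_mul_choose_eq (p + 1) i)
  rw [e1, e2, e3]
  simp only [Nat.succ_eq_add_one, Nat.choose_succ_succ' (p + 1) i] at hA ⊢
  push_cast at hA ⊢
  have d1 : (i : ℝ) + p + 1 + 2 - (i + 1) = p + 2 := by ring
  have d2 : (i : ℝ) + p + 1 + 1 - (i + 1) = p + 1 := by ring
  have d3 : (i : ℝ) + p + 1 - i = p + 1 := by ring
  have h1 : (p : ℝ) + 1 ≠ 0 := by positivity
  have h2 : (p : ℝ) + 2 ≠ 0 := by positivity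
  rw [d1, d2, d3]
  field_simp
  linear_combination hA

lemma fpoly_odd_add_two (k : ℕ) (t : ℝ) :
    fpoly (2 * k + 1 + 2) t = fpoly (2 * k + 1 + 1) t + fpoly (2 * k + 1) t := by
  unfold fpoly
  have e1 : (2 * k + 1 + 2) / 2 = k + 1 := by omega
  have e2 : (2 * k + 1 + 1) / 2 = k + 1 := by omega
  have e3 : (2 * k + 1) / 2 = k := by omega
  rw [e1, e2, e3, Finset.sum_range_succ' _ (k + 1), Finset.sum_range_succ' _ (k + 1),
    add_right_comm (_ : ℝ), ← Finset.sum_add_distrib]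
  congr 1
  · refine Finset.sum_congr rfl fun i hi => ?_
    rw [dickson_coeff_succ_succ (by have := Finset.mem_range.mp hi; omega),
      Nat.add_sub_add_right k 1 i, add_mul]
  · have h1 : ((2 * k + 1 + 2 : ℕ) : ℝ) ≠ 0 := by positivity
    have h2 : ((2 * k + 1 + 1 : ℕ) : ℝ) ≠ 0 := by positivity
    simp only [Nat.cast_zero, sub_zero, Nat.choose_zero_right, div_self h1, div_self h2]

lemma fpoly_even_add_two (k : ℕ) (t : ℝ) :
    fpoly (2 * (k + 1) + 2) t =
      (-2 * t - 2) * fpoly (2 * (k + 1) + 1) t + fpoly (2 * (k + 1)) t := by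
  unfold fpoly
  have e1 : (2 * (k + 1) + 2) / 2 = k + 2 := by omega
  have e2 : (2 * (k + 1) + 1) / 2 = k + 1 := by omega
  have e3 : 2 * (k + 1) / 2 = k + 1 := by omega
  have extend : ∀ g : ℕ → ℝ, ∑ i ∈ Finset.range (k + 1 + 1),
      (((2 * (k + 1) + 1 : ℕ) : ℝ) / (((2 * (k + 1) + 1 : ℕ) : ℝ) - (i : ℝ))) *
        (Nat.choose (2 * (k + 1) + 1 - i) i : ℝ) * g i =
      ∑ i ∈ Finset.range (k + 2 + 1),
      (((2 * (k + 1) + 1 : ℕ) : ℝ) / (((2 * (k + 1) + 1 : ℕ) : ℝ) - (i : ℝ))) *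
        (Nat.choose (2 * (k + 1) + 1 - i) i : ℝ) * g i := by
    intro g
    rw [Finset.sum_range_succ _ (k + 2), Nat.choose_eq_zero_of_lt (by omega)]
    simp
  rw [e1, e2, e3, extend, Finset.sum_range_succ' _ (k + 2), Finset.sum_range_succ' _ (k + 2),
    mul_add (-2 * t - 2), add_right_comm (_ : ℝ), Finset.mul_sum, ← Finset.sum_add_distrib]
  congr 1
  · refine Finset.sum_congr rfl fun i hi => ?_
    have hi' := Finset.mem_range.mp hi
    rw [dickson_coeff_succ_succ (by omega), add_mul,
      show k + 2 - (i + 1) = k + 1 - i by omega]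
    congr 1
    rcases Nat.lt_or_ge i (k + 1) with h | h
    · rw [show k + 1 - i = k + 1 - (i + 1) + 1 by omega, pow_succ]
      ring
    · rw [Nat.choose_eq_zero_of_lt (show 2 * (k + 1) + 1 - (i + 1) < i + 1 by omega)]
      simp
  · have h1 : ((2 * (k + 1) + 2 : ℕ) : ℝ) ≠ 0 := by positivity
    have h2 : ((2 * (k + 1) + 1 : ℕ) : ℝ) ≠ 0 := by positivity
    simp only [Nat.cast_zero, sub_zero, Nat.choose_zero_right, div_self h1, div_self h2]
    rw [Nat.sub_zero, Nat.sub_zero, pow_succ _ (k + 1)]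
    ring

/-- The polynomials `fpoly` at `cos (2α)` compute cosines of multiples of `α`. -/
lemma fpoly_cos (α : ℝ) (k : ℕ) :
    cos α * ((-1) ^ k * fpoly (2 * k + 1) (cos (2 * α))) = cos ((2 * k + 1) * α) ∧
    (-1) ^ (k + 1) * fpoly (2 * (k + 1)) (cos (2 * α)) = 2 * cos ((2 * k + 2) * α) := by
  induction k with
  | zero =>
    constructor
    · simp [fpoly]
    · simp [fpoly, Finset.sum_range_succ]
      norm_num
  | succ k ih =>
    obtain ⟨h1, h2⟩ := ih
    have key : ∀ x : ℝ, cos (x + α) = 2 * cos α * cos x - cos (x - α) := by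
      intro x; rw [cos_add, cos_sub]; ring
    have h3 : cos α * ((-1) ^ (k + 1) * fpoly (2 * (k + 1) + 1) (cos (2 * α))) =
        cos ((2 * (k + 1 : ℕ) + 1) * α) := by
      have := key ((2 * k + 2) * α)
      rw [show (2 * k + 2) * α - α = (2 * k + 1) * α by ring, ← h1] at this
      rw [show (2 * ((k + 1 : ℕ) : ℝ) + 1) * α = (2 * k + 2) * α + α by push_cast; ring, this,
        show 2 * (k + 1) + 1 = 2 * k + 1 + 2 by ring, fpoly_odd_add_two,
        show 2 * k + 1 + 1 = 2 * (k + 1) by ring]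
      rw [pow_succ] at h2 ⊢
      linear_combination cos α * h2
    refine ⟨h3, ?_⟩
    have := key ((2 * (k + 1 : ℕ) + 1) * α)
    rw [← h3, show (2 * ((k + 1 : ℕ) : ℝ) + 1) * α - α = (2 * k + 2) * α by push_cast; ring]
      at this
    rw [show (2 * ((k + 1 : ℕ) : ℝ) + 2) * α = (2 * (k + 1 : ℕ) + 1) * α + α by push_cast; ring,
      this, show 2 * (k + 1 + 1) = 2 * (k + 1) + 2 by ring, fpoly_even_add_two]
    rw [pow_succ _ (k + 1)]
    have hc : -2 * cos (2 * α) - 2 = -4 * cos α ^ 2 := by rw [cos_two_mul]; ring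
    rw [hc]
    linear_combination -h2

/-- The factor relating `fpoly n (cos φ)` and `cos (n φ / 2)` is shared, up to sign, by indices
differing by two. -/
lemma exists_fpoly_eq_mul_cos {φ : ℝ} (hφ : cos (φ / 2) ≠ 0) {n : ℕ} (hn : 1 ≤ n) :
    ∃ c : ℝ, c ≠ 0 ∧ fpoly n (cos φ) = c * cos (n * φ / 2) ∧
      fpoly (n + 2) (cos φ) = -c * cos (((n : ℝ) + 2) * φ / 2) := by
  have hpow : ∀ k : ℕ, ((-1 : ℝ) ^ k) * (-1) ^ k = 1 := fun k => by
    rw [← mul_pow]; simp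
  have hφ2 : 2 * (φ / 2) = φ := by ring
  rcases Nat.even_or_odd' n with ⟨k, rfl | rfl⟩
  · obtain ⟨j, rfl⟩ : ∃ j, k = j + 1 := ⟨k - 1, by omega⟩
    have h1 := (fpoly_cos (φ / 2) j).2
    have h2 := (fpoly_cos (φ / 2) (j + 1)).2
    rw [hφ2] at h1 h2
    refine ⟨2 * (-1) ^ (j + 1), by simp, ?_, ?_⟩
    · rw [show ((2 * (j + 1) : ℕ) : ℝ) * φ / 2 = (2 * j + 2) * (φ / 2) by push_cast; ring]
      linear_combination (-1) ^ (j + 1) * h1 - fpoly (2 * (j + 1)) (cos φ) * hpow (j + 1)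
    · rw [show (((2 * (j + 1) : ℕ) : ℝ) + 2) * φ / 2 = (2 * (j + 1 : ℕ) + 2) * (φ / 2) by
        push_cast; ring, show 2 * (j + 1) + 2 = 2 * (j + 1 + 1) by ring]
      rw [pow_succ _ (j + 1)] at h2
      linear_combination -(-1) ^ (j + 1) * h2 -
        fpoly (2 * (j + 1 + 1)) (cos φ) * hpow (j + 1)
  · have h1 := (fpoly_cos (φ / 2) k).1
    have h2 := (fpoly_cos (φ / 2) (k + 1)).1
    rw [hφ2] at h1 h2
    refine ⟨(-1) ^ k / cos (φ / 2), by simp [hφ], ?_, ?_⟩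
    · rw [show ((2 * k + 1 : ℕ) : ℝ) * φ / 2 = (2 * k + 1) * (φ / 2) by push_cast; ring, ← h1]
      field_simp
      linear_combination -fpoly (2 * k + 1) (cos φ) * hpow k
    · rw [show (((2 * k + 1 : ℕ) : ℝ) + 2) * φ / 2 = (2 * (k + 1 : ℕ) + 1) * (φ / 2) by
        push_cast; ring, ← h2, show 2 * k + 1 + 2 = 2 * (k + 1) + 1 by ring, pow_succ]
      field_simp
      linear_combination -fpoly (2 * (k + 1) + 1) (cos φ) * hpow k

lemma Fm_denom_pos {m : ℕ} (hm : 2 ≤ m) {φ : ℝ}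
    (hφ : φ ∈ Icc (π / ((m : ℝ) + 1)) (π / m)) : 0 < cos (((m : ℝ) - 1) * φ / 2) := by
  have hm' : (2 : ℝ) ≤ m := by exact_mod_cast hm
  have h0 : 0 < φ := lt_of_lt_of_le (by positivity) hφ.1
  have h2 : φ * m ≤ π := (le_div_iff₀ (by positivity)).mp hφ.2
  refine cos_pos_of_mem_Ioo ⟨?_, ?_⟩
  · have : 0 ≤ ((m : ℝ) - 1) * φ / 2 := by
      have : 0 ≤ (m : ℝ) - 1 := by linarith
      positivity
    linarith [pi_pos]
  · linarith

lemma Fm_mem_Icc {m : ℕ} (hm : 2 ≤ m) {φ : ℝ}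
    (hφ : φ ∈ Icc (π / ((m : ℝ) + 1)) (π / m)) : Fm m φ ∈ Icc (0 : ℝ) 1 := by
  have hm' : (2 : ℝ) ≤ m := by exact_mod_cast hm
  have h0 : 0 < φ := lt_of_lt_of_le (by positivity) hφ.1
  have h1 : π ≤ φ * (m + 1) := (div_le_iff₀ (by positivity)).mp hφ.1
  have h2 : φ * m ≤ π := (le_div_iff₀ (by positivity)).mp hφ.2
  have h3 : φ * 2 ≤ φ * m := by gcongr
  have hd := Fm_denom_pos hm hφ
  constructor
  · refine div_nonneg ?_ hd.le
    have := cos_nonpos_of_pi_div_two_le_of_le (x := ((m : ℝ) + 1) * φ / 2)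
      (by linarith) (by linarith)
    linarith
  · refine (div_le_one hd).mpr ?_
    rw [← cos_pi_sub]
    refine cos_le_cos_of_nonneg_of_le_pi ?_ (by linarith) (by linarith)
    nlinarith

lemma eq_pi_div_of_Fm_eq_zero {m : ℕ} (hm : 2 ≤ m) {φ : ℝ}
    (hφ : φ ∈ Icc (π / ((m : ℝ) + 1)) (π / m)) (h : Fm m φ = 0) : φ = π / ((m : ℝ) + 1) := by
  have hm' : (2 : ℝ) ≤ m := by exact_mod_cast hm
  have h0 : 0 < φ := lt_of_lt_of_le (by positivity) hφ.1
  have h2 : φ * m ≤ π := (le_div_iff₀ (by positivity)).mp hφ.2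
  have h3 : φ * 2 ≤ φ * m := by gcongr
  have hd := Fm_denom_pos hm hφ
  have hz : cos (((m : ℝ) + 1) * φ / 2) = cos (π / 2) := by
    rcases div_eq_zero_iff.mp h with h | h
    · rw [cos_pi_div_two]; linarith
    · exact absurd h hd.ne'
  have := injOn_cos ⟨by positivity, by linarith⟩ ⟨by positivity, by linarith [pi_pos]⟩ hz
  rw [eq_div_iff (by positivity)]
  linarith

lemma Fm_pi_div_self {m : ℕ} (hm : 2 ≤ m) : Fm m (π / m) = 1 := by
  have hm' : (2 : ℝ) ≤ m := by exact_mod_cast hm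
  have hmem : π / m ∈ Icc (π / ((m : ℝ) + 1)) (π / m) :=
    ⟨by gcongr; linarith, le_rfl⟩
  have hd := Fm_denom_pos hm hmem
  unfold Fm
  rw [div_eq_one_iff_eq hd.ne', ← cos_pi_sub]
  congr 1
  field_simp
  ring

lemma uN_eq {q m : ℕ} (hq : 2 ≤ q) {u : ℝ} (hu : 0 ≤ u) :
    uN q m (1 + ((q : ℝ) ^ (((m : ℝ) + 1) / 2) + (q : ℝ) ^ ((m : ℝ) / 2) * u) /
      (1 + √q * u)) = u := by
  have hq' : (2 : ℝ) ≤ q := by exact_mod_cast hq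
  have hq0 : (0 : ℝ) < q := by linarith
  have hs : 0 < √(q : ℝ) := sqrt_pos.mpr hq0
  have hs2 : √(q : ℝ) ^ 2 = q := sq_sqrt hq0.le
  have e1 : (q : ℝ) ^ ((m : ℝ) / 2) = (q : ℝ) ^ (((m : ℝ) - 1) / 2) * √q := by
    rw [sqrt_eq_rpow, ← rpow_add hq0]; congr 1; ring
  have e2 : (q : ℝ) ^ (((m : ℝ) + 1) / 2) = (q : ℝ) ^ (((m : ℝ) - 1) / 2) * √q ^ 2 := by
    rw [hs2, ← rpow_add_one hq0.ne']; congr 1; ring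
  have hA : 0 < (q : ℝ) ^ (((m : ℝ) - 1) / 2) := rpow_pos_of_pos hq0 _
  unfold uN
  rw [e1, e2]
  generalize (q : ℝ) ^ (((m : ℝ) - 1) / 2) = A at hA
  have hs1 : √(q : ℝ) ^ 2 - 1 ≠ 0 := by rw [hs2]; linarith
  generalize √(q : ℝ) = s at *
  have hd : 0 < 1 + s * u := by positivity
  have e3 : 1 + (A * s ^ 2 + A * s * u) / (1 + s * u) - 1 - A =
      A * (s ^ 2 - 1) / (1 + s * u) := by field_simp; ring
  rw [e3, show A * s ^ 2 - A = A * (s ^ 2 - 1) by ring]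
  have : A * (s ^ 2 - 1) ≠ 0 := mul_ne_zero hA.ne' hs1
  rw [div_div_cancel₀ this]
  field_simp
  ring

/-- The explicit preimage of `cos φ` under `θ_q`. -/
lemma IsTheta.apply_of_Fm {q : ℕ} (hq : 2 ≤ q) {θ : ℝ → ℝ} (hθ : IsTheta q θ) {m : ℕ}
    (hm : 2 ≤ m) {φ : ℝ} (hφ : φ ∈ Icc (π / ((m : ℝ) + 1)) (π / m)) {N : ℝ}
    (hN : N = 1 + ((q : ℝ) ^ (((m : ℝ) + 1) / 2) + (q : ℝ) ^ ((m : ℝ) / 2) * Fm m φ) /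
      (1 + √q * Fm m φ)) :
    (q : ℝ) + 1 ≤ N ∧ θ N = cos φ := by
  have hq' : (2 : ℝ) ≤ q := by exact_mod_cast hq
  have hm' : (2 : ℝ) ≤ m := by exact_mod_cast hm
  have hq0 : (0 : ℝ) < q := by linarith
  have hs1 : 1 < √(q : ℝ) := by rw [lt_sqrt (by norm_num)]; linarith
  have e1 : ∀ x : ℝ, (q : ℝ) ^ ((x + 1) / 2) = (q : ℝ) ^ (x / 2) * √q := fun x => by
    rw [sqrt_eq_rpow, ← rpow_add hq0]; congr 1; ring
  have hB : 0 < (q : ℝ) ^ ((m : ℝ) / 2) := rpow_pos_of_pos hq0 _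
  have hBq : (q : ℝ) ≤ (q : ℝ) ^ ((m : ℝ) / 2) := by
    conv_lhs => rw [← rpow_one (q : ℝ)]
    exact rpow_le_rpow_of_exponent_le (by linarith) (by linarith)
  obtain ⟨hu0, hu1⟩ := Fm_mem_Icc hm hφ
  have hd : 0 < 1 + √(q : ℝ) * Fm m φ := by positivity
  have hlow : (q : ℝ) ^ ((m : ℝ) / 2) ≤ N - 1 := by
    rw [hN, add_sub_cancel_left, le_div_iff₀ hd, e1]
    nlinarith [mul_nonneg hB.le (mul_nonneg (sub_nonneg.mpr hs1.le) (sub_nonneg.mpr hu1))]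
  have hNq : (q : ℝ) + 1 ≤ N := by linarith
  refine ⟨hNq, ?_⟩
  rcases hu0.eq_or_lt with h0 | h0
  · have hφe := eq_pi_div_of_Fm_eq_zero hm hφ h0.symm
    have hcast : ((m + 1 : ℕ) : ℝ) = (m : ℝ) + 1 := by push_cast; ring
    have hN1 : N - 1 = (q : ℝ) ^ (((m : ℝ) + 1) / 2) := by
      rw [hN, ← h0]; simp
    have hC : 0 < (q : ℝ) ^ (((m : ℝ) + 1) / 2) := rpow_pos_of_pos hq0 _
    refine hθ N hNq (m + 1) (by omega) (by rw [hcast]; exact hN1.ge) ?_ φ ?_ ?_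
    · rw [hN1, hcast, e1 ((m : ℝ) + 1)]
      exact lt_mul_of_one_lt_right hC hs1
    · rw [hφe, hcast]
      exact ⟨by gcongr; linarith, le_rfl⟩
    · have hF : Fm (m + 1) φ = 1 := by
        rw [hφe, ← hcast]; exact Fm_pi_div_self (by omega)
      have hN' : N = 1 + ((q : ℝ) ^ ((((m + 1 : ℕ) : ℝ) + 1) / 2) +
          (q : ℝ) ^ (((m + 1 : ℕ) : ℝ) / 2) * 1) / (1 + √q * 1) := by
        rw [hcast, e1 ((m : ℝ) + 1), ← hN1]
        field_simp
        ring
      rw [hF, hN', uN_eq hq zero_le_one]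
  · refine hθ N hNq m hm hlow ?_ φ hφ ?_
    · rw [hN, add_sub_cancel_left, div_lt_iff₀ hd, e1]
      have : 0 < (√(q : ℝ) ^ 2 - 1) * Fm m φ * (q : ℝ) ^ ((m : ℝ) / 2) := by
        have : 0 < √(q : ℝ) ^ 2 - 1 := by nlinarith
        positivity
      nlinarith
    · rw [hN, uN_eq hq hu0]

/-- Let `q ≥ 2` be an integer and `θ_q^{−1} : [0,1) → [q+1,∞)` the inverse of the
bijection `θ_q`.  For every integer `m ≥ 2` and every
`t ∈ [cos(π/m), cos(π/(m+1))]`, one has `f_{m−1}(t) ≠ 0` and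
`θ_q^{−1}(t) = 1 + (q^{(m+1)/2} + q^{m/2}·u)/(1 + √q·u)` where
`u = f_{m+1}(t)/f_{m−1}(t)`. -/
theorem stmt_4 (q : ℕ) (hq : 2 ≤ q) (θ : ℝ → ℝ) (hθ : IsTheta q θ)
    (hbij : Set.BijOn θ (Set.Ici ((q : ℝ) + 1)) (Set.Ico 0 1))
    (m : ℕ) (hm : 2 ≤ m) (t : ℝ)
    (ht : t ∈ Set.Icc (Real.cos (π / (m : ℝ))) (Real.cos (π / ((m : ℝ) + 1)))) :
    fpoly (m - 1) t ≠ 0 ∧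
    ∀ N : ℝ, (q : ℝ) + 1 ≤ N → θ N = t →
      N = 1 + ((q : ℝ) ^ (((m : ℝ) + 1) / 2)
            + (q : ℝ) ^ ((m : ℝ) / 2) * (fpoly (m + 1) t / fpoly (m - 1) t)) /
          (1 + Real.sqrt q * (fpoly (m + 1) t / fpoly (m - 1) t)) := by
  have hm' : (2 : ℝ) ≤ m := by exact_mod_cast hm
  obtain ⟨φ, hφ, rfl⟩ : ∃ φ ∈ Icc (π / ((m : ℝ) + 1)) (π / m), cos φ = t := by
    have hle : π / ((m : ℝ) + 1) ≤ π / m := by gcongr; linarith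
    exact intermediate_value_Icc' hle continuous_cos.continuousOn ht
  have h0 : 0 < φ := lt_of_lt_of_le (by positivity) hφ.1
  have h2 : φ * m ≤ π := (le_div_iff₀ (by positivity)).mp hφ.2
  have h3 : φ * 2 ≤ φ * m := by gcongr
  have hhalf : 0 < cos (φ / 2) :=
    cos_pos_of_mem_Ioo ⟨by linarith [pi_pos], by linarith [pi_pos]⟩
  have hd := Fm_denom_pos hm hφ
  obtain ⟨c, hc, hf1, hf2⟩ := exists_fpoly_eq_mul_cos hhalf.ne' (n := m - 1) (by omega)
  have hcast : ((m - 1 : ℕ) : ℝ) = (m : ℝ) - 1 := by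
    rw [Nat.cast_sub (by omega), Nat.cast_one]
  rw [hcast] at hf1 hf2
  rw [show m - 1 + 2 = m + 1 by omega, show (m : ℝ) - 1 + 2 = m + 1 by ring] at hf2
  have hu : fpoly (m + 1) (cos φ) / fpoly (m - 1) (cos φ) = Fm m φ := by
    rw [hf1, hf2, Fm, neg_mul, ← mul_neg, mul_div_mul_left _ _ hc]
  refine ⟨by rw [hf1]; exact mul_ne_zero hc hd.ne', fun N hN hNt => ?_⟩
  rw [hu]
  obtain ⟨hN0, hθN0⟩ := hθ.apply_of_Fm hq hm hφ rfl
  exact hbij.injOn hN hN0 (hNt.trans hθN0.symm)
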